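/- arXiv:1703.04817 — 2 statements merged into one kernel-verified Lean document; each statement's English description precedes it below -/
import Mathlib

section
/- Let d ≥ 1, let a, w_1,…,w_d ∈ ℂ with Re(a) > 0 and Re(w_i) > 0, and let N be a non-negative integer. Let s : ℕ → ℂ and r > 0 satisfy Σ_{n=0}^∞ s_n z^n/n! = z^d ∏_{i=1}^d (e^{w_i z} − 1)^{−1} for all z with 0 < |z| < r. For α ∈ ℂ and n ∈ ℕ_0^d set T(α,n) = (a+n·w)^{−α} − Σ_{m=0}^{N} (s_m/m!) · (Γ(1−α)/Γ(d−α−m+1)) · G[(a+n·w+x)^{d−α−m}]_{x=w} (principal-branch powers). Then for every compact set K ⊆ {α ∈ ℂ : Re(α) > d − 1 − N} containing no positive integer, the partial sums α ↦ Σ_{n∈{0,…,M}^d} T(α,n) converge uniformly on K, as M → ∞, to α ↦ Σ_{n∈ℕ_0^d} T(α,n). -/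
open Complex Filter

/-- Coefficients of `∏ (exp (w i z) - 1)`. -/
noncomputable def barnesE {d : ℕ} (w : Fin d → ℂ) (j : ℕ) : ℂ :=
  ∑ S : Finset (Fin d), (-1 : ℂ) ^ (d - S.card) * ((∑ i ∈ S, w i) ^ j / (j.factorial : ℂ))

lemma barnes_prod_expand {R : Type*} [CommRing R] {d : ℕ} (f : Fin d → R) :
    ∏ i, (f i - 1) = ∑ S : Finset (Fin d), (-1 : R) ^ (d - S.card) * ∏ i ∈ S, f i := by
  classical
  simp only [sub_eq_add_neg]
  rw [Finset.prod_add]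
  simp only [Finset.powerset_univ, Finset.prod_const]
  refine Finset.sum_congr rfl fun S _ => ?_
  rw [mul_comm, ← Finset.compl_eq_univ_sdiff, Finset.card_compl, Fintype.card_fin]

lemma barnes_prod_rescale {d : ℕ} (w : Fin d → ℂ) (S : Finset (Fin d)) :
    ∏ i ∈ S, PowerSeries.rescale (w i) (PowerSeries.exp ℂ) =
      PowerSeries.rescale (∑ i ∈ S, w i) (PowerSeries.exp ℂ) := by
  classical
  induction S using Finset.induction_on with
  | empty => simp
  | insert i S hi ih =>
    rw [Finset.prod_insert hi, Finset.sum_insert hi, ih, PowerSeries.exp_mul_exp_eq_exp_add]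

lemma barnesE_eq_zero {d : ℕ} (w : Fin d → ℂ) (j : ℕ) (hj : j < d) : barnesE w j = 0 := by
  have h1 : (PowerSeries.X : PowerSeries ℂ) ^ d ∣
      ∏ i, (PowerSeries.rescale (w i) (PowerSeries.exp ℂ) - 1) := by
    have : (PowerSeries.X : PowerSeries ℂ) ^ d = ∏ i : Fin d, PowerSeries.X := by simp
    rw [this]
    refine Finset.prod_dvd_prod_of_dvd _ _ fun i _ => ?_
    rw [PowerSeries.X_dvd_iff, map_sub, ← PowerSeries.coeff_zero_eq_constantCoeff_apply,
      PowerSeries.coeff_rescale]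
    simp
  have h2 := PowerSeries.X_pow_dvd_iff.1 h1 j hj
  rw [barnes_prod_expand] at h2
  rw [← h2, barnesE, map_sum]
  refine Finset.sum_congr rfl fun S _ => ?_
  rw [barnes_prod_rescale]
  have : ((-1 : PowerSeries ℂ) ^ (d - S.card)) = PowerSeries.C ((-1 : ℂ) ^ (d - S.card)) := by simp
  rw [this, PowerSeries.coeff_C_mul, PowerSeries.coeff_rescale, PowerSeries.coeff_exp]
  simp [div_eq_mul_inv]

lemma barnesE_hasSum {d : ℕ} (w : Fin d → ℂ) (z : ℂ) :
    HasSum (fun j => barnesE w j * z ^ j) (∏ i, (Complex.exp (w i * z) - 1)) := by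
  rw [barnes_prod_expand]
  have : (fun j => barnesE w j * z ^ j) = fun j => ∑ S : Finset (Fin d),
      (-1 : ℂ) ^ (d - S.card) * (((∑ i ∈ S, w i) * z) ^ j / (j.factorial : ℂ)) := by
    ext j
    rw [barnesE, Finset.sum_mul]
    refine Finset.sum_congr rfl fun S _ => ?_
    rw [mul_pow]; ring
  rw [this]
  refine hasSum_sum fun S _ => HasSum.mul_left _ ?_
  rw [← Complex.exp_sum, ← Finset.sum_mul, Complex.exp_eq_exp_ℂ]
  exact NormedSpace.expSeries_div_hasSum_exp _

lemma barnes_conv {d : ℕ} (hd : 1 ≤ d) (w : Fin d → ℂ) (hw : ∀ i, 0 < (w i).re)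
    (s : ℕ → ℂ) (r : ℝ) (hr : 0 < r)
    (hs : ∀ z : ℂ, 0 < ‖z‖ → ‖z‖ < r →
      HasSum (fun n : ℕ => s n * z ^ n / (n.factorial : ℂ))
        (z ^ d * ∏ i, (Complex.exp (w i * z) - 1)⁻¹)) (k : ℕ) :
    ∑ p ∈ Finset.HasAntidiagonal.antidiagonal k, s p.1 / (p.1.factorial : ℂ) * barnesE w p.2 =
      if k = d then 1 else 0 := by
  set c : ℕ → ℂ := fun k =>
    ∑ p ∈ Finset.HasAntidiagonal.antidiagonal k, s p.1 / (p.1.factorial : ℂ) * barnesE w p.2 with hc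
  have hev : ∀ᶠ z : ℂ in nhds 0, ∀ i, ‖w i * z‖ < 2 * Real.pi := by
    rw [eventually_all]
    intro i
    have : Continuous fun z : ℂ => ‖w i * z‖ := by fun_prop
    have h0 := this.tendsto 0
    simp only [mul_zero, norm_zero] at h0
    exact h0.eventually_lt_const (by positivity)
  have hevr : ∀ᶠ z : ℂ in nhds 0, ‖z‖ < r := by
    have h0 := (continuous_norm (E := ℂ)).tendsto 0
    simp only [norm_zero] at h0
    exact h0.eventually_lt_const hr
  have h1 : HasFPowerSeriesAt (fun z : ℂ => z ^ d) (FormalMultilinearSeries.ofScalars ℂ c) 0 := by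
    rw [hasFPowerSeriesAt_iff]
    filter_upwards [hev, hevr] with z hz hzr
    simp only [FormalMultilinearSeries.coeff_ofScalars, zero_add, smul_eq_mul]
    rcases eq_or_ne z 0 with rfl | hz0
    · have := hasSum_single (f := fun n => (0 : ℂ) ^ n * c n) 0 (by intro n hn; simp [hn])
      have h0 : c 0 = 0 := by simp [hc, barnesE_eq_zero w 0 hd]
      simpa [h0, (show d ≠ 0 by omega)] using this
    · have hA := hs z (norm_pos_iff.2 hz0) hzr
      have hB := barnesE_hasSum w z
      have hAB := tsum_mul_tsum_eq_tsum_sum_antidiagonal_of_summable_norm hA.summable.norm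
        hB.summable.norm
      have hS := (summable_norm_sum_mul_antidiagonal_of_summable_norm hA.summable.norm
        hB.summable.norm).of_norm
      have hH := hS.hasSum
      rw [← hAB, hA.tsum_eq, hB.tsum_eq, mul_assoc, ← Finset.prod_mul_distrib,
        Finset.prod_eq_one, mul_one] at hH
      · convert hH using 2 with n
        rw [hc, Finset.mul_sum]
        refine Finset.sum_congr rfl fun p hp => ?_
        rw [← Finset.HasAntidiagonal.mem_antidiagonal.1 hp, pow_add]
        ring
      · intro i _
        apply inv_mul_cancel₀
        rw [sub_ne_zero]
        intro he
        obtain ⟨n, hn⟩ := Complex.exp_eq_one_iff.1 he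
        have hwi : w i ≠ 0 := by
          intro h; have := hw i; simp [h] at this
        have hn0 : n ≠ 0 := by
          rintro rfl
          simp [hwi, hz0] at hn
        have hlt := hz i
        rw [hn] at hlt
        have hp := Real.pi_pos
        have : (1 : ℝ) ≤ |(n : ℝ)| := by exact_mod_cast Int.one_le_abs hn0
        simp [abs_of_pos hp] at hlt
        nlinarith
  have h2 : HasFPowerSeriesAt (fun z : ℂ => z ^ d)
      (FormalMultilinearSeries.ofScalars ℂ (fun k => if k = d then (1 : ℂ) else 0)) 0 := by
    rw [hasFPowerSeriesAt_iff]
    filter_upwards with z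
    simp only [FormalMultilinearSeries.coeff_ofScalars, zero_add, smul_eq_mul]
    have := hasSum_single (f := fun n => z ^ n * if n = d then (1 : ℂ) else 0) d
      (by intro n hn; simp [hn])
    simpa using this
  have h3 := congrArg (fun p => p.coeff k) (h1.eq_formalMultilinearSeries h2)
  simpa [FormalMultilinearSeries.coeff_ofScalars] using h3

lemma barnes_comb {d : ℕ} (hd : 1 ≤ d) (w : Fin d → ℂ) (hw : ∀ i, 0 < (w i).re)
    (s : ℕ → ℂ) (r : ℝ) (hr : 0 < r)
    (hs : ∀ z : ℂ, 0 < ‖z‖ → ‖z‖ < r →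
      HasSum (fun n : ℕ => s n * z ^ n / (n.factorial : ℂ))
        (z ^ d * ∏ i, (Complex.exp (w i * z) - 1)⁻¹)) (N : ℕ) (D : ℕ → ℂ) :
    ∑ m ∈ Finset.range (N + 1), s m / (m.factorial : ℂ) *
      ∑ S : Finset (Fin d), (-1 : ℂ) ^ (d - S.card) *
        ∑ j ∈ Finset.range (N + d + 1 - m),
          D (m + j) * (∑ i ∈ S, w i) ^ j / (j.factorial : ℂ) = D d := by
  have h1 : ∀ m, s m / (m.factorial : ℂ) *
      ∑ S : Finset (Fin d), (-1 : ℂ) ^ (d - S.card) *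
        ∑ j ∈ Finset.range (N + d + 1 - m),
          D (m + j) * (∑ i ∈ S, w i) ^ j / (j.factorial : ℂ) =
      ∑ j ∈ Finset.range (N + d + 1 - m), s m / (m.factorial : ℂ) * barnesE w j * D (m + j) := by
    intro m
    simp only [Finset.mul_sum, barnesE, Finset.sum_mul]
    rw [Finset.sum_comm]
    refine Finset.sum_congr rfl fun j _ => Finset.sum_congr rfl fun S _ => ?_
    ring
  simp only [h1]
  have h2 : ∑ m ∈ Finset.range (N + 1), ∑ j ∈ Finset.range (N + d + 1 - m),
        s m / (m.factorial : ℂ) * barnesE w j * D (m + j) =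
      ∑ m ∈ Finset.range (N + d + 1), ∑ j ∈ Finset.range (N + d + 1 - m),
        s m / (m.factorial : ℂ) * barnesE w j * D (m + j) := by
    refine Finset.sum_subset (Finset.range_mono (by omega)) fun m hm hm' => ?_
    refine Finset.sum_eq_zero fun j hj => ?_
    simp only [Finset.mem_range] at hm hm' hj
    rw [barnesE_eq_zero w j (by omega)]
    ring
  rw [h2, ← Finset.sum_range_diag_flip (N + d + 1)
    (fun m j => s m / (m.factorial : ℂ) * barnesE w j * D (m + j))]
  have h3 : ∀ k, ∑ m ∈ Finset.range (k + 1), s m / (m.factorial : ℂ) * barnesE w (k - m) *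
      D (m + (k - m)) = (if k = d then 1 else 0) * D k := by
    intro k
    rw [← barnes_conv hd w hw s r hr hs k, Finset.sum_mul,
      Finset.Nat.sum_antidiagonal_eq_sum_range_succ_mk]
    refine Finset.sum_congr rfl fun m hm => ?_
    rw [Finset.mem_range] at hm
    rw [show m + (k - m) = k by omega]
  simp only [h3]
  simp

lemma barnes_taylor (n : ℕ) : ∀ (h : ℕ → ℝ → ℂ) (C : ℝ),
    (∀ j, ∀ t ∈ Set.Icc (0 : ℝ) 1, HasDerivAt (h j) (h (j + 1) t) t) →
    (∀ t ∈ Set.Icc (0 : ℝ) 1, ‖h n t‖ ≤ C) →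
    ∀ t ∈ Set.Icc (0 : ℝ) 1,
      ‖h 0 t - ∑ j ∈ Finset.range n, h j 0 * (t : ℂ) ^ j / (j.factorial : ℂ)‖ ≤ C := by
  induction n with
  | zero => intro h C _ hC t ht; simpa using hC t ht
  | succ n ih =>
    intro h C hD hC t ht
    have ih' := ih (fun j => h (j + 1)) C (fun j => hD (j + 1)) hC
    have hder : ∀ x ∈ Set.Icc (0 : ℝ) 1, HasDerivWithinAt
        (fun t : ℝ => h 0 t - ∑ j ∈ Finset.range (n + 1), h j 0 * (t : ℂ) ^ j / (j.factorial : ℂ))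
        (h 1 x - ∑ j ∈ Finset.range n, h (j + 1) 0 * (x : ℂ) ^ j / (j.factorial : ℂ))
        (Set.Icc 0 1) x := by
      intro x hx
      refine (HasDerivAt.sub (hD 0 x hx) ?_).hasDerivWithinAt
      simp only [Finset.sum_range_succ']
      simp only [pow_zero, mul_one]
      refine HasDerivAt.add_const _ (HasDerivAt.fun_sum fun j _ => ?_)
      have h1 : HasDerivAt (fun t : ℝ => (t : ℂ)) 1 x := Complex.ofRealCLM.hasDerivAt
      have h2 := ((h1.pow (j + 1)).const_mul (h (j + 1) 0)).div_const ((j + 1).factorial : ℂ)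
      refine h2.congr_deriv ?_
      have : ((j : ℂ) + 1) ≠ 0 := by exact_mod_cast Nat.succ_ne_zero j
      have : (j.factorial : ℂ) ≠ 0 := by exact_mod_cast j.factorial_ne_zero
      rw [Nat.factorial_succ]
      push_cast
      field_simp
    have := (convex_Icc (0 : ℝ) 1).norm_image_sub_le_of_norm_hasDerivWithin_le hder ih'
      (Set.left_mem_Icc.2 zero_le_one) ht
    have h0 : h 0 0 - ∑ j ∈ Finset.range (n + 1), h j 0 * ((0 : ℝ) : ℂ) ^ j / (j.factorial : ℂ)
        = 0 := by
      rw [Finset.sum_range_succ']; simp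
    rw [h0, sub_zero, sub_zero, Real.norm_of_nonneg ht.1] at this
    have hC0 : 0 ≤ C := (norm_nonneg _).trans (hC t ht)
    exact this.trans (mul_le_of_le_one_right hC0 ht.2)

lemma barnes_summable {d : ℕ} (hd : 1 ≤ d) (σ : ℝ) (hσ : (d : ℝ) < σ) :
    Summable fun n : Fin d → ℕ => (1 + ∑ i, (n i : ℝ)) ^ (-σ) := by
  have hd0 : (0 : ℝ) < d := by exact_mod_cast hd
  set p : ℝ := σ / d with hp
  have hp1 : 1 < p := by rw [hp, lt_div_iff₀ hd0]; simpa using hσ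
  set g : ℕ → ℝ := fun k => ((k : ℝ) + 1) ^ (-p) with hg
  have hg0 : ∀ k, 0 ≤ g k := fun k => by positivity
  have hgs : Summable g := by
    have := (summable_nat_add_iff 1).2 (Real.summable_nat_rpow.2 (show -p < -1 by linarith))
    simpa [hg] using this
  have hprod : Summable fun n : Fin d → ℕ => ∏ i, g (n i) := by
    refine summable_of_sum_le (c := ∏ _i : Fin d, ∑' k, g k)
      (fun n => Finset.prod_nonneg fun i _ => hg0 _) fun u => ?_
    have hsub : u ⊆ Fintype.piFinset fun i => u.image fun n => n i := by
      intro n hn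
      rw [Fintype.mem_piFinset]
      exact fun i => Finset.mem_image_of_mem _ hn
    refine (Finset.sum_le_sum_of_subset_of_nonneg hsub
      fun n _ _ => Finset.prod_nonneg fun i _ => hg0 _).trans ?_
    rw [← Finset.prod_univ_sum (fun i => u.image fun n => n i) (fun _ => g)]
    exact Finset.prod_le_prod (fun i _ => Finset.sum_nonneg fun _ _ => hg0 _)
      fun i _ => hgs.sum_le_tsum _ fun _ _ => hg0 _
  refine hprod.of_nonneg_of_le (fun n => by positivity) fun n => ?_
  have hX : 0 < 1 + ∑ i, (n i : ℝ) := by positivity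
  have : (1 + ∑ i, (n i : ℝ)) ^ (-σ) = ∏ _i : Fin d, (1 + ∑ i, (n i : ℝ)) ^ (-p) := by
    rw [Finset.prod_const, ← Real.rpow_natCast, ← Real.rpow_mul hX.le]
    congr 1
    simp [hp]; field_simp
  rw [this]
  refine Finset.prod_le_prod (fun i _ => by positivity) fun i _ => ?_
  refine Real.rpow_le_rpow_of_nonpos (by positivity) ?_ (by linarith)
  have := Finset.single_le_sum (f := fun i => (n i : ℝ)) (fun i _ => by positivity)
    (Finset.mem_univ i)
  linarith

/-- Gamma quotient. -/
noncomputable def barnesC (d : ℕ) (α : ℂ) (m : ℕ) : ℂ :=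
  Complex.Gamma (1 - α) / Complex.Gamma ((d : ℂ) - α - (m : ℂ) + 1)

lemma barnesC_succ (d : ℕ) (α : ℂ) (m : ℕ) :
    barnesC d α (m + 1) = barnesC d α m * ((d : ℂ) - α - (m : ℂ)) := by
  have := Complex.one_div_Gamma_eq_self_mul_one_div_Gamma_add_one ((d : ℂ) - α - (m : ℂ))
  rw [barnesC, barnesC, div_eq_mul_inv, div_eq_mul_inv]
  rw [show (d : ℂ) - α - ((m + 1 : ℕ) : ℂ) + 1 = (d : ℂ) - α - (m : ℂ) by push_cast; ring, this]
  ring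

lemma barnes_one_sub_ne {α : ℂ} (hα : ∀ k : ℕ, 1 ≤ k → (k : ℂ) ≠ α) (m : ℕ) :
    1 - α ≠ -(m : ℂ) := by
  intro h
  apply hα (m + 1) (by omega)
  push_cast
  linear_combination h

lemma barnesC_self (d : ℕ) (α : ℂ) (hα : ∀ k : ℕ, 1 ≤ k → (k : ℂ) ≠ α) : barnesC d α d = 1 := by
  rw [barnesC, show (d : ℂ) - α - (d : ℂ) + 1 = 1 - α by ring, div_self]
  exact Complex.Gamma_ne_zero (barnes_one_sub_ne hα)

lemma barnesC_bdd (d : ℕ) (K : Set ℂ) (hK : IsCompact K)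
    (hKint : ∀ k : ℕ, 1 ≤ k → (k : ℂ) ∉ K) (m : ℕ) :
    ∃ B, ∀ α ∈ K, ‖barnesC d α m‖ ≤ B := by
  refine hK.exists_bound_of_continuousOn ?_
  have h1 : ContinuousOn (fun α : ℂ => Complex.Gamma (1 - α)) K := by
    intro α hα
    have := (Complex.differentiableAt_Gamma (1 - α)
      (barnes_one_sub_ne fun k hk h => hKint k hk (h ▸ hα))).continuousAt
    exact (ContinuousAt.comp (f := fun α : ℂ => 1 - α) this (by fun_prop)).continuousWithinAt
  have h2 : Continuous (fun α : ℂ => (Complex.Gamma ((d : ℂ) - α - (m : ℂ) + 1))⁻¹) :=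
    Complex.differentiable_one_div_Gamma.continuous.comp (by fun_prop)
  simpa only [barnesC, div_eq_mul_inv] using h1.fun_mul h2.continuousOn

lemma barnes_remainder (d N : ℕ) (α b x : ℂ) (hb : 0 < b.re) (hx : 0 ≤ x.re) (C : ℝ)
    (hC : ∀ t ∈ Set.Icc (0 : ℝ) 1, ‖(b + t * x) ^ (-(α + N + 1))‖ ≤ C) (m : ℕ) (hm : m ≤ N) :
    ‖barnesC d α m * (b + x) ^ ((d : ℂ) - α - (m : ℂ)) -
      ∑ j ∈ Finset.range (N + d + 1 - m),
        (barnesC d α (m + j) * b ^ ((d : ℂ) - α - ((m + j : ℕ) : ℂ))) * x ^ j / (j.factorial : ℂ)‖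
      ≤ ‖barnesC d α (N + d + 1)‖ * C * ‖x‖ ^ (N + d + 1 - m) := by
  have key := barnes_taylor (N + d + 1 - m)
    (fun j t => barnesC d α (m + j) * (b + t * x) ^ ((d : ℂ) - α - ((m + j : ℕ) : ℂ)) * x ^ j)
    (‖barnesC d α (N + d + 1)‖ * C * ‖x‖ ^ (N + d + 1 - m)) ?_ ?_ 1 (by simp)
  · simp only [add_zero, ofReal_one, one_mul, pow_zero, mul_one, ofReal_zero, zero_mul,
      one_pow] at key
    exact key
  · intro j t ht
    have h1 : HasDerivAt (fun t : ℝ => (t : ℂ)) 1 t := Complex.ofRealCLM.hasDerivAt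
    have h2 : HasDerivAt (fun u : ℂ => b + u * x) x (t : ℂ) := by
      simpa using ((hasDerivAt_id (t : ℂ)).mul_const x).const_add b
    have hsl : b + (t : ℂ) * x ∈ slitPlane := by
      left
      simp
      have := mul_nonneg ht.1 hx
      linarith
    have h3 := (((h2.cpow_const (c := (d : ℂ) - α - ((m + j : ℕ) : ℂ)) hsl).const_mul
      (barnesC d α (m + j))).mul_const (x ^ j)).comp_ofReal
    refine h3.congr_deriv ?_
    rw [← add_assoc, barnesC_succ,
      show (d : ℂ) - α - ((m + j + 1 : ℕ) : ℂ) = (d : ℂ) - α - ((m + j : ℕ) : ℂ) - 1 by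
        push_cast; ring]
    ring
  · intro t ht
    rw [show m + (N + d + 1 - m) = N + d + 1 by omega,
      show (d : ℂ) - α - ((N + d + 1 : ℕ) : ℂ) = -(α + N + 1) by push_cast; ring,
      norm_mul, norm_mul, norm_pow]
    gcongr
    exact hC t ht

lemma barnes_pow_bound (c X σ R I : ℝ) (hc : 0 < c) (hc1 : c ≤ 1) (hX : 1 ≤ X) (β z : ℂ)
    (hz : c * X ≤ z.re) (hσ0 : 0 ≤ σ) (hσ : σ ≤ β.re) (hR : β.re ≤ R) (hI : |β.im| ≤ I) :
    ‖z ^ (-β)‖ ≤ c ^ (-R) * Real.exp (Real.pi * I) * X ^ (-σ) := by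
  have hX0 : 0 < X := by linarith
  have hcX : 0 < c * X := by positivity
  have hzn : c * X ≤ ‖z‖ := hz.trans (Complex.re_le_norm z)
  have h1 : ‖z‖ ^ (-β.re) ≤ c ^ (-R) * X ^ (-σ) := by
    calc ‖z‖ ^ (-β.re) ≤ (c * X) ^ (-β.re) :=
          Real.rpow_le_rpow_of_nonpos hcX hzn (by linarith)
      _ = c ^ (-β.re) * X ^ (-β.re) := Real.mul_rpow hc.le hX0.le
      _ ≤ c ^ (-R) * X ^ (-σ) := by
          gcongr ?_ * ?_
          · exact Real.rpow_le_rpow_of_exponent_ge hc hc1 (by linarith)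
          · exact Real.rpow_le_rpow_of_exponent_le hX (by linarith)
  have h2 : (Real.exp (z.arg * (-β).im))⁻¹ ≤ Real.exp (Real.pi * I) := by
    rw [← Real.exp_neg, Real.exp_le_exp]
    have h3 : |z.arg * β.im| ≤ Real.pi * I := by
      rw [abs_mul]
      exact mul_le_mul (Complex.abs_arg_le_pi z) hI (abs_nonneg _) Real.pi_pos.le
    simpa using (le_abs_self _).trans h3
  calc ‖z ^ (-β)‖ ≤ ‖z‖ ^ (-β).re / Real.exp (z.arg * (-β).im) := Complex.norm_cpow_le _ _
    _ = ‖z‖ ^ (-β.re) * (Real.exp (z.arg * (-β).im))⁻¹ := by rw [div_eq_mul_inv, Complex.neg_re]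
    _ ≤ (c ^ (-R) * X ^ (-σ)) * Real.exp (Real.pi * I) := by gcongr
    _ = _ := by ring

/-- Uniform convergence of the series in Barnes' representation on compact subsets of
`{Re(α) > d − 1 − N}` avoiding the positive integers. -/
theorem barnes_series_tendstoUniformlyOn (d : ℕ) (hd : 1 ≤ d) (a : ℂ) (w : Fin d → ℂ)
    (ha : 0 < a.re) (hw : ∀ i, 0 < (w i).re) (N : ℕ)
    (s : ℕ → ℂ) (r : ℝ) (hr : 0 < r)
    (hs : ∀ z : ℂ, 0 < ‖z‖ → ‖z‖ < r →
      HasSum (fun n : ℕ => s n * z ^ n / (n.factorial : ℂ))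
        (z ^ d * ∏ i, (Complex.exp (w i * z) - 1)⁻¹))
    (T : ℂ → (Fin d → ℕ) → ℂ)
    (hT : ∀ α n, T α n =
      (a + ∑ i, (n i : ℂ) * w i) ^ (-α) -
        ∑ m ∈ Finset.range (N + 1), s m / (m.factorial : ℂ) *
          (Complex.Gamma (1 - α) / Complex.Gamma ((d : ℂ) - α - (m : ℂ) + 1)) *
          ∑ S : Finset (Fin d), (-1 : ℂ) ^ (d - S.card) *
            (a + (∑ i, (n i : ℂ) * w i) + ∑ i ∈ S, w i) ^ ((d : ℂ) - α - (m : ℂ)))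
    (K : Set ℂ) (hK : IsCompact K)
    (hKre : K ⊆ {α : ℂ | (d : ℝ) - 1 - N < α.re})
    (hKint : ∀ k : ℕ, 1 ≤ k → (k : ℂ) ∉ K) :
    TendstoUniformlyOn
      (fun (M : ℕ) (α : ℂ) =>
        ∑ n ∈ Fintype.piFinset (fun _ : Fin d => Finset.range (M + 1)), T α n)
      (fun α => ∑' n : Fin d → ℕ, T α n) atTop K := by

  rcases K.eq_empty_or_nonempty with rfl | hne
  · exact tendstoUniformlyOn_empty
  -- constants
  obtain ⟨α₀, hα₀, hmin⟩ := hK.exists_isMinOn hne Complex.continuous_re.continuousOn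
  obtain ⟨B, hB⟩ := hK.exists_bound_of_continuousOn (f := fun α : ℂ => α) continuousOn_id
  obtain ⟨Q, hQ⟩ := barnesC_bdd d K hK hKint (N + d + 1)
  set σ : ℝ := α₀.re + N + 1 with hσdef
  have hσ : (d : ℝ) < σ := by
    have := hKre hα₀
    simp only [Set.mem_ofPred_eq] at this
    linarith
  obtain ⟨c, hc, hc1, hca, hcw⟩ :
      ∃ c : ℝ, 0 < c ∧ c ≤ 1 ∧ c ≤ a.re ∧ ∀ i, c ≤ (w i).re := by
    have hne' : (Finset.univ : Finset (Fin d)).Nonempty := ⟨⟨0, hd⟩, Finset.mem_univ _⟩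
    obtain ⟨i₀, _, hi₀⟩ := Finset.exists_min_image Finset.univ (fun i => (w i).re) hne'
    refine ⟨min 1 (min a.re (w i₀).re), ?_, min_le_left _ _, ?_, fun i => ?_⟩
    · exact lt_min one_pos (lt_min ha (hw i₀))
    · exact (min_le_right _ _).trans (min_le_left _ _)
    · exact (min_le_right _ _).trans ((min_le_right _ _).trans (hi₀ i (Finset.mem_univ _)))
  set L : ℝ := c ^ (-(B + N + 1)) * Real.exp (Real.pi * B) with hL
  have hL0 : 0 ≤ L := by positivity
  set W : ℝ := ∑ m ∈ Finset.range (N + 1), ‖s m / (m.factorial : ℂ)‖ *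
    ∑ S : Finset (Fin d), (Q * L * ‖∑ i ∈ S, w i‖ ^ (N + d + 1 - m)) with hW
  have hbound : ∀ (n : Fin d → ℕ), ∀ α ∈ K,
      ‖T α n‖ ≤ W * (1 + ∑ i, (n i : ℝ)) ^ (-σ) := by
    intro n α hα
    set b : ℂ := a + ∑ i, (n i : ℂ) * w i with hb
    set X : ℝ := 1 + ∑ i, (n i : ℝ) with hX
    have hX1 : 1 ≤ X := by
      have : (0 : ℝ) ≤ ∑ i, (n i : ℝ) := Finset.sum_nonneg fun i _ => by positivity
      linarith
    have hbre : c * X ≤ b.re := by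
      have : b.re = a.re + ∑ i, (n i : ℝ) * (w i).re := by simp [hb]
      rw [this, hX, mul_add, mul_one, Finset.mul_sum]
      refine add_le_add hca (Finset.sum_le_sum fun i _ => ?_)
      rw [mul_comm]
      exact mul_le_mul_of_nonneg_left (hcw i) (by positivity)
    have hb0 : 0 < b.re := lt_of_lt_of_le (by positivity) hbre
    have hαint : ∀ k : ℕ, 1 ≤ k → (k : ℂ) ≠ α := fun k hk h => hKint k hk (h ▸ hα)
    have hwS : ∀ S : Finset (Fin d), 0 ≤ (∑ i ∈ S, w i).re := by
      intro S
      rw [Complex.re_sum]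
      exact Finset.sum_nonneg fun i _ => (hw i).le
    have hpow : ∀ S : Finset (Fin d), ∀ t ∈ Set.Icc (0 : ℝ) 1,
        ‖(b + t * ∑ i ∈ S, w i) ^ (-(α + N + 1))‖ ≤ L * X ^ (-σ) := by
      intro S t ht
      have hm : α₀.re ≤ α.re := hmin hα
      have hB' : ‖α‖ ≤ B := hB α hα
      refine barnes_pow_bound c X σ (B + N + 1) B hc hc1 hX1 _ _ ?_ ?_ ?_ ?_ ?_
      · have := mul_nonneg ht.1 (hwS S)
        have h4 : (b + t * ∑ i ∈ S, w i).re = b.re + t * (∑ i ∈ S, w i).re := by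
          rw [Complex.add_re, Complex.re_ofReal_mul]
        rw [h4]; linarith
      · have : (0 : ℝ) ≤ d := by positivity
        linarith
      · simp [hσdef]; exact hm
      · have := Complex.re_le_norm α
        simp; linarith
      · have := Complex.abs_im_le_norm α
        simp; linarith
    have hcomb := barnes_comb hd w hw s r hr hs N
      (fun k => barnesC d α k * b ^ ((d : ℂ) - α - (k : ℂ)))
    simp only [barnesC_self d α hαint, one_mul] at hcomb
    rw [show (d : ℂ) - α - (d : ℂ) = -α by ring] at hcomb
    have hTe : T α n = -∑ m ∈ Finset.range (N + 1), s m / (m.factorial : ℂ) *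
        ∑ S : Finset (Fin d), (-1 : ℂ) ^ (d - S.card) *
          (barnesC d α m * (b + ∑ i ∈ S, w i) ^ ((d : ℂ) - α - (m : ℂ)) -
            ∑ j ∈ Finset.range (N + d + 1 - m),
              (barnesC d α (m + j) * b ^ ((d : ℂ) - α - ((m + j : ℕ) : ℂ))) *
                (∑ i ∈ S, w i) ^ j / (j.factorial : ℂ)) := by
      simp only [mul_sub, Finset.sum_sub_distrib]
      rw [hcomb, hT, neg_sub]
      congr 1
      refine Finset.sum_congr rfl fun m _ => ?_
      rw [mul_assoc]
      congr 1
      rw [Finset.mul_sum]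
      refine Finset.sum_congr rfl fun S _ => ?_
      rw [barnesC]
      ring
    rw [hTe, norm_neg, hW, Finset.sum_mul]
    refine norm_sum_le_of_le _ fun m hm => ?_
    rw [norm_mul, mul_assoc]
    refine mul_le_mul_of_nonneg_left ?_ (norm_nonneg _)
    rw [Finset.sum_mul]
    refine norm_sum_le_of_le _ fun S _ => ?_
    rw [norm_mul, norm_pow, norm_neg, norm_one, one_pow, one_mul]
    refine (barnes_remainder d N α b _ hb0 (hwS S) _ (hpow S) m
      (Nat.lt_succ_iff.1 (Finset.mem_range.1 hm))).trans ?_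
    have hX0 : 0 ≤ X ^ (-σ) := by positivity
    calc _ ≤ Q * (L * X ^ (-σ)) * ‖∑ i ∈ S, w i‖ ^ (N + d + 1 - m) := by
          gcongr
          exact hQ α hα
      _ = _ := by ring
  have huni := tendstoUniformlyOn_tsum (f := fun n α => T α n)
    ((barnes_summable hd σ hσ).mul_left W) hbound
  have htend : Tendsto (fun M : ℕ => Fintype.piFinset (fun _ : Fin d => Finset.range (M + 1)))
      atTop atTop := by
    refine tendsto_atTop_finset_of_monotone ?_ ?_
    · intro M M' h
      exact Fintype.piFinset_subset _ _ fun _ => Finset.range_mono (by omega)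
    · intro n
      refine ⟨∑ i, n i, ?_⟩
      rw [Fintype.mem_piFinset]
      intro i
      rw [Finset.mem_range]
      exact Nat.lt_succ_of_le (Finset.single_le_sum (fun _ _ => Nat.zero_le _)
        (Finset.mem_univ i))
  intro u hu
  exact htend.eventually (huni u hu)
end

section
/- Let d ≥ 1, let w_1,…,w_d, c ∈ ℂ with Re(w_i) > 0 and Re(c) > 0, let M be a non-negative integer, and let α ∈ ℂ with Re(α) > d. Let b : ℕ → ℂ and r > 0 satisfy Σ_{k=0}^∞ b_k z^k/k! = z^d e^{−cz} ∏_{i=1}^d w_i/(e^{w_i z} − 1) for all z with 0 < |z| < r. Then Σ_{n∈ℕ_0^d, n≠0} (n·w)^{−α} = (Γ(α) ∏_{i=1}^d w_i)^{−1} Σ_{k=0}^{M} (−1)^k b_k Γ(α−d+k)/(k! · c^{α−d+k}) − (Γ(α) c^{α})^{−1} Σ_{k=0}^{M−d} Γ(α+k)/k! + Γ(α)^{−1} ∫_0^∞ t^{α−1} ( ∏_{i=1}^d (1−e^{−w_i t})^{−1} − 1 − (t^{−d} e^{−ct}/∏_{i=1}^d w_i) Σ_{k=0}^{M} (−1)^k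 b_k t^k/k! + e^{−ct} Σ_{k=0}^{M−d} (ct)^k/k! ) dt, where the sum Σ_{k=0}^{M−d} is empty (equal to 0) if M < d, the series over n converges absolutely, the integrand is Lebesgue integrable on (0,∞), and all complex powers are principal-branch. -/
open Complex MeasureTheory Set

lemma aux_mul {𝕜 ι : Type*} [NormedField 𝕜] [CompleteSpace 𝕜] (f : ℕ → 𝕜) (g : ι → 𝕜) (s : 𝕜)
    (hf : Summable fun n => ‖f n‖) (h1 : Summable fun n => ‖g n‖) (h2 : HasSum g s) :
    Summable (fun x : ℕ × ι => ‖f x.1 * g x.2‖) ∧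
    HasSum (fun x : ℕ × ι => f x.1 * g x.2) ((∑' n, f n) * s) := by
  have h3 := Summable.mul_norm hf h1
  exact ⟨h3, hf.of_norm.hasSum.mul h2 h3.of_norm⟩

lemma aux_pi {𝕜 : Type*} [NormedField 𝕜] [CompleteSpace 𝕜] (d : ℕ) (f : Fin d → ℕ → 𝕜)
    (hf : ∀ i, Summable fun n => ‖f i n‖) :
    Summable (fun n : Fin d → ℕ => ‖∏ i, f i (n i)‖) ∧
    HasSum (fun n : Fin d → ℕ => ∏ i, f i (n i)) (∏ i, ∑' n, f i n) := by
  induction d with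
  | zero =>
    refine ⟨(hasSum_unique _).summable, ?_⟩
    simp
  | succ d ih =>
    obtain ⟨h1, h2⟩ := ih (fun i => f i.succ) (fun i => hf i.succ)
    obtain ⟨h3, h4⟩ := aux_mul (f 0) _ _ (hf 0) h1 h2
    constructor
    · rw [← (Fin.consEquiv (fun _ : Fin (d + 1) => ℕ)).summable_iff]
      refine h3.congr fun x => ?_
      simp [Fin.consEquiv, Fin.prod_univ_succ]
    · rw [← (Fin.consEquiv (fun _ : Fin (d + 1) => ℕ)).hasSum_iff, Fin.prod_univ_succ]
      convert h4 using 2 with x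
      simp [Fin.consEquiv, Fin.prod_univ_succ]

lemma aux_summ (d : ℕ) (hd : 1 ≤ d) (σ : ℝ) (hσ : (d : ℝ) < σ) :
    Summable (fun n : Fin d → ℕ => (1 + ∑ i, (n i : ℝ)) ^ (-σ)) := by
  have hd0 : (0 : ℝ) < d := by exact_mod_cast hd
  have key := (aux_pi (𝕜 := ℝ) d (fun _ n => ((n : ℝ) + 1) ^ (-(σ / d))) (fun i => by
    have h : Summable (fun n : ℕ => (n : ℝ) ^ (-(σ / d))) := by
      rw [Real.summable_nat_rpow]
      have : 1 < σ / d := by rwa [lt_div_iff₀ hd0, one_mul]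
      linarith
    have h' := ((summable_nat_add_iff 1).2 h)
    refine h'.norm.congr fun n => ?_
    push_cast; rfl)).2.summable
  refine key.of_nonneg_of_le (fun n => by positivity) fun n => ?_
  rw [Real.finsetProd_rpow _ _ (fun i _ => by positivity)]
  have h1 : ∏ i : Fin d, ((n i : ℝ) + 1) ≤ (1 + ∑ i, (n i : ℝ)) ^ d := by
    calc ∏ i : Fin d, ((n i : ℝ) + 1) ≤ ∏ i : Fin d, (1 + ∑ i, (n i : ℝ)) := by
          refine Finset.prod_le_prod (fun i _ => by positivity) fun i _ => ?_
          have := Finset.single_le_sum (f := fun i => (n i : ℝ)) (fun i _ => by positivity)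
            (Finset.mem_univ i)
          linarith
      _ = _ := by simp
  have h2 : (1 + ∑ i, (n i : ℝ)) ^ (-σ) = ((1 + ∑ i, (n i : ℝ)) ^ d) ^ (-(σ / d)) := by
    rw [← Real.rpow_natCast, ← Real.rpow_mul (by positivity)]
    congr 1; field_simp
  rw [h2]
  exact Real.rpow_le_rpow_of_nonpos (by positivity) h1 (by
    have : 0 < σ / d := div_pos (hd0.trans hσ) hd0
    linarith)

lemma aux_norm (a c : ℂ) {t : ℝ} (ht : 0 < t) :
    ‖(t : ℂ) ^ (a - 1) * Complex.exp (-c * t)‖ = t ^ (a.re - 1) * Real.exp (-(c.re * t)) := by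
  rw [norm_mul, norm_cpow_eq_rpow_re_of_pos ht, Complex.norm_exp]
  simp

lemma aux_rint {a c : ℝ} (ha : 0 < a) (hc : 0 < c) :
    IntegrableOn (fun t : ℝ => t ^ (a - 1) * Real.exp (-(c * t))) (Ioi 0) := by
  have := integrableOn_rpow_mul_exp_neg_mul_rpow (p := 1) (s := a - 1) (b := c) (by linarith)
    one_pos hc
  simpa using this

lemma aux_meas (a c : ℂ) : Measurable (fun t : ℝ => (t : ℂ) ^ (a - 1) * Complex.exp (-c * t)) := by
  fun_prop

lemma aux_int {a c : ℂ} (ha : 0 < a.re) (hc : 0 < c.re) :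
    IntegrableOn (fun t : ℝ => (t : ℂ) ^ (a - 1) * Complex.exp (-c * t)) (Ioi 0) := by
  refine (aux_rint ha hc).mono' (aux_meas a c).aestronglyMeasurable ?_
  filter_upwards [ae_restrict_mem measurableSet_Ioi] with t ht
  exact (aux_norm a c ht).le

lemma aux_deriv {a c : ℂ} (ha : 0 < a.re) (hc : 0 < c.re) :
    DifferentiableAt ℂ (fun c : ℂ => ∫ t in Ioi (0 : ℝ), (t : ℂ) ^ (a - 1) * Complex.exp (-c * t))
      c := by
  have hball : ∀ x ∈ Metric.ball c (c.re / 2), c.re / 2 ≤ x.re := by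
    intro x hx
    have h1 := (Complex.abs_re_le_norm (x - c)).trans_lt (by simpa [dist_eq_norm] using hx)
    have := (abs_lt.1 h1).1
    simp at this
    linarith
  have := hasDerivAt_integral_of_dominated_loc_of_deriv_le (𝕜 := ℂ) (μ := volume.restrict (Ioi (0:ℝ)))
    (F := fun (c : ℂ) (t : ℝ) => (t : ℂ) ^ (a - 1) * Complex.exp (-c * t))
    (F' := fun (c : ℂ) (t : ℝ) => (t : ℂ) ^ (a - 1) * (Complex.exp (-c * t) * (-1 * t)))
    (x₀ := c) (s := Metric.ball c (c.re / 2))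
    (bound := fun t : ℝ => t ^ ((a.re + 1) - 1) * Real.exp (-(c.re / 2 * t)))
    (Metric.ball_mem_nhds _ (by linarith)) 
    (Filter.Eventually.of_forall fun x => (aux_meas a x).aestronglyMeasurable)
    (aux_int ha hc)
    (Measurable.aestronglyMeasurable (by fun_prop)) 
    (by
      filter_upwards [ae_restrict_mem measurableSet_Ioi] with t (ht : 0 < t) x hx
      rw [← mul_assoc, norm_mul, aux_norm a x ht]
      have e : t ^ ((a.re + 1) - 1) = t ^ (a.re - 1) * t := by
        rw [show a.re + 1 - 1 = (a.re - 1) + 1 by ring, Real.rpow_add_one ht.ne']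
      have e2 : ‖(-1 * t : ℂ)‖ = t := by simp [ht.le]
      rw [e, e2, mul_right_comm]
      gcongr
      exact hball x hx)
    (aux_rint (by linarith) (by linarith))
    (Filter.Eventually.of_forall fun t x hx => by
      refine HasDerivAt.const_mul _ (HasDerivAt.cexp ?_)
      exact ((hasDerivAt_id x).neg.mul_const (t : ℂ)))
  exact this.2.differentiableAt

lemma aux_gamma {a c : ℂ} (ha : 0 < a.re) (hc : 0 < c.re) :
    ∫ t in Ioi (0 : ℝ), (t : ℂ) ^ (a - 1) * Complex.exp (-c * t) = Complex.Gamma a * c ^ (-a) := by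
  have hU : IsOpen {z : ℂ | 0 < z.re} := isOpen_lt continuous_const continuous_re
  have h1 : AnalyticOnNhd ℂ (fun c : ℂ => ∫ t in Ioi (0 : ℝ), (t : ℂ) ^ (a - 1) * Complex.exp (-c * t))
      {z : ℂ | 0 < z.re} :=
    DifferentiableOn.analyticOnNhd (fun z hz => (aux_deriv ha hz).differentiableWithinAt) hU
  have h2 : AnalyticOnNhd ℂ (fun c : ℂ => Complex.Gamma a * c ^ (-a)) {z : ℂ | 0 < z.re} :=
    DifferentiableOn.analyticOnNhd (fun z hz => by
      refine DifferentiableAt.differentiableWithinAt ?_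
      refine DifferentiableAt.const_mul ?_ _
      exact differentiableAt_id.cpow_const (Or.inl hz)) hU
  have hconn : IsPreconnected {z : ℂ | 0 < z.re} := (convex_halfSpace_re_gt 0).isPreconnected
  refine h1.eqOn_of_preconnected_of_frequently_eq h2 hconn (z₀ := 1) (by simp) ?_ hc
  have hreal : ∀ x : ℝ, 0 < x → ∫ t in Ioi (0 : ℝ), (t : ℂ) ^ (a - 1) * Complex.exp (-(x : ℂ) * t)
      = Complex.Gamma a * (x : ℂ) ^ (-a) := by
    intro x hx
    have := integral_cpow_mul_exp_neg_mul_Ioi ha hx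
    simp_rw [neg_mul]
    rw [this, mul_comm, one_div, inv_cpow _ _ (arg_ofReal_of_nonneg hx.le ▸ Real.pi_pos.ne), cpow_neg]
  have ht : Filter.Tendsto (fun n : ℕ => ((1 + 1 / ((n : ℝ) + 1) : ℝ) : ℂ)) Filter.atTop
      (nhdsWithin 1 {1}ᶜ) := by
    refine tendsto_nhdsWithin_iff.2 ⟨?_, Filter.Eventually.of_forall fun n => ?_⟩
    · have := (tendsto_one_div_add_atTop_nhds_zero_nat (𝕜 := ℝ)).const_add 1
      have := (Complex.continuous_ofReal.tendsto _).comp this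
      simpa [Function.comp_def] using this
    · have : (0 : ℝ) < 1 / ((n : ℝ) + 1) := by positivity
      simp only [mem_compl_iff, mem_singleton_iff]
      intro h
      have : (1 + 1 / ((n : ℝ) + 1) : ℝ) = 1 := by exact_mod_cast h
      linarith
  exact ht.frequently (Filter.Frequently.of_forall fun n => hreal _ (by positivity))

lemma aux_series {ι : Type*} [Countable ι] (p : ι → ℂ) (hp : ∀ i, 0 < (p i).re) {α : ℂ}
    (hα : 0 < α.re) (hs : Summable fun i => (p i).re ^ (-α.re)) (G : ℝ → ℂ) (hG : Measurable G)
    (hGs : ∀ t : ℝ, 0 < t → HasSum (fun i => Complex.exp (-(p i) * t)) (G t)) :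
    Summable (fun i => ‖(p i) ^ (-α)‖) ∧
    IntegrableOn (fun t : ℝ => (t : ℂ) ^ (α - 1) * G t) (Ioi 0) ∧
    ∫ t in Ioi (0 : ℝ), (t : ℂ) ^ (α - 1) * G t = Complex.Gamma α * ∑' i, (p i) ^ (-α) := by
  have hnorm : ∀ i, ∫ t in Ioi (0 : ℝ), ‖(t : ℂ) ^ (α - 1) * Complex.exp (-(p i) * t)‖
      = Real.Gamma α.re * (p i).re ^ (-α.re) := by
    intro i
    rw [setIntegral_congr_fun measurableSet_Ioi (fun t ht => aux_norm α (p i) ht),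
      Real.integral_rpow_mul_exp_neg_mul_Ioi hα (hp i), mul_comm, one_div,
      Real.inv_rpow (hp i).le, Real.rpow_neg (hp i).le]
  have hS : Summable fun i => ∫ t in Ioi (0 : ℝ), ‖(t : ℂ) ^ (α - 1) * Complex.exp (-(p i) * t)‖ := by
    simp_rw [hnorm]
    exact hs.mul_left _
  have hsum := hasSum_integral_of_summable_integral_norm
    (F := fun i (t : ℝ) => (t : ℂ) ^ (α - 1) * Complex.exp (-(p i) * t))
    (μ := volume.restrict (Ioi (0 : ℝ))) (fun i => aux_int hα (hp i)) hS
  have hpt : ∀ t : ℝ, 0 < t → ∑' i, (t : ℂ) ^ (α - 1) * Complex.exp (-(p i) * t)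
      = (t : ℂ) ^ (α - 1) * G t := fun t ht => ((hGs t ht).mul_left _).tsum_eq
  refine ⟨?_, ?_, ?_⟩
  · refine (hs.mul_right (Real.exp (Real.pi * |α.im|))).of_nonneg_of_le (fun _ => norm_nonneg _)
      fun i => ?_
    refine (norm_cpow_le _ _).trans ?_
    rw [div_eq_mul_inv, ← Real.exp_neg]
    have h1 : ‖p i‖ ^ (-α).re ≤ (p i).re ^ (-α.re) := by
      rw [neg_re]
      exact Real.rpow_le_rpow_of_nonpos (hp i) (Complex.re_le_norm _) (by linarith)
    have h2 : -(arg (p i) * (-α).im) ≤ Real.pi * |α.im| := by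
      rw [neg_im, mul_neg, neg_neg]
      refine (le_abs_self _).trans ?_
      rw [abs_mul]
      gcongr
      exact Complex.abs_arg_le_pi _
    have := hp i
    gcongr
  · refine ⟨Measurable.aestronglyMeasurable (by fun_prop), ?_⟩
    have hle : ∫⁻ t in Ioi (0 : ℝ), ‖(t : ℂ) ^ (α - 1) * G t‖ₑ
        ≤ ∫⁻ t in Ioi (0 : ℝ), ∑' i, ‖(t : ℂ) ^ (α - 1) * Complex.exp (-(p i) * t)‖ₑ := by
      refine setLIntegral_mono' measurableSet_Ioi fun t ht => ?_
      rw [← hpt t ht]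
      exact enorm_tsum_le_tsum_enorm
    refine hle.trans_lt ?_
    rw [lintegral_tsum (fun i => (aux_meas α (p i)).enorm.aemeasurable)]
    have (i : ι) : ∫⁻ t in Ioi (0 : ℝ), ‖(t : ℂ) ^ (α - 1) * Complex.exp (-(p i) * t)‖ₑ
        = ENNReal.ofReal (∫ t in Ioi (0 : ℝ), ‖(t : ℂ) ^ (α - 1) * Complex.exp (-(p i) * t)‖) :=
      (ofReal_integral_norm_eq_lintegral_enorm (aux_int hα (hp i))).symm
    simp_rw [this]
    exact hS.tsum_ofReal_lt_top
  · rw [← setIntegral_congr_fun measurableSet_Ioi (fun t ht => hpt t ht), ← hsum.tsum_eq,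
      ← tsum_mul_left]
    exact tsum_congr fun i => aux_gamma hα (hp i)

/-- Integral representation of the homogeneous Barnes zeta function (the homogeneous
analogue of Ruijsenaars' representation), evaluated in the common region of
convergence `Re(α) > d`. The sums `∑_{k=0}^{M−d}` are realized as sums over
`Finset.range (M + 1 - d)`, which are empty when `M < d`. -/
theorem homogeneous_barnes_integral_representation (d : ℕ) (hd : 1 ≤ d)
    (w : Fin d → ℂ) (c : ℂ) (hw : ∀ i, 0 < (w i).re) (hc : 0 < c.re) (M : ℕ)
    (α : ℂ) (hα : (d : ℝ) < α.re)
    (b : ℕ → ℂ) (r : ℝ) (hr : 0 < r)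
    (hb : ∀ z : ℂ, 0 < ‖z‖ → ‖z‖ < r →
      HasSum (fun k : ℕ => b k * z ^ k / (k.factorial : ℂ))
        (z ^ d * Complex.exp (-c * z) * ∏ i, w i / (Complex.exp (w i * z) - 1))) :
    Summable (fun n : {n : Fin d → ℕ // n ≠ 0} => ‖(∑ i, (n.1 i : ℂ) * w i) ^ (-α)‖) ∧
    IntegrableOn (fun t : ℝ =>
      (t : ℂ) ^ (α - 1) *
        ((∏ i, (1 - Complex.exp (-(w i) * t))⁻¹) - 1 -
          (t : ℂ) ^ (-(d : ℂ)) * Complex.exp (-c * t) / (∏ i, w i) *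
            ∑ k ∈ Finset.range (M + 1), (-1 : ℂ) ^ k * b k * (t : ℂ) ^ k / (k.factorial : ℂ) +
          Complex.exp (-c * t) *
            ∑ k ∈ Finset.range (M + 1 - d), (c * t) ^ k / (k.factorial : ℂ)))
      (Ioi 0) ∧
    ∑' n : {n : Fin d → ℕ // n ≠ 0}, (∑ i, (n.1 i : ℂ) * w i) ^ (-α)
      = (Complex.Gamma α * ∏ i, w i)⁻¹ *
          ∑ k ∈ Finset.range (M + 1),
            (-1 : ℂ) ^ k * b k * Complex.Gamma (α - d + k) /
              ((k.factorial : ℂ) * c ^ (α - d + k))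
        - (Complex.Gamma α * c ^ α)⁻¹ *
            ∑ k ∈ Finset.range (M + 1 - d), Complex.Gamma (α + k) / (k.factorial : ℂ)
        + (Complex.Gamma α)⁻¹ *
            ∫ t in Ioi (0 : ℝ),
              (t : ℂ) ^ (α - 1) *
                ((∏ i, (1 - Complex.exp (-(w i) * t))⁻¹) - 1 -
                  (t : ℂ) ^ (-(d : ℂ)) * Complex.exp (-c * t) / (∏ i, w i) *
                    ∑ k ∈ Finset.range (M + 1),
                      (-1 : ℂ) ^ k * b k * (t : ℂ) ^ k / (k.factorial : ℂ) +
                  Complex.exp (-c * t) *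
                    ∑ k ∈ Finset.range (M + 1 - d), (c * t) ^ k / (k.factorial : ℂ)) := by
  have hσ0 : (0 : ℝ) < α.re := lt_of_le_of_lt (Nat.cast_nonneg d) hα
  have hGne : Complex.Gamma α ≠ 0 := Complex.Gamma_ne_zero_of_re_pos hσ0
  have hc0 : c ≠ 0 := by rintro rfl; simp at hc
  have : Nonempty (Fin d) := ⟨⟨0, hd⟩⟩
  obtain ⟨i₀, hi₀⟩ := Finite.exists_min (fun i => (w i).re)
  set δ := (w i₀).re with hδ
  have hδ0 : 0 < δ := hw i₀
  have hre : ∀ n : {n : Fin d → ℕ // n ≠ 0},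
      δ / 2 * (1 + ∑ i, (n.1 i : ℝ)) ≤ (∑ i, (n.1 i : ℂ) * w i).re := by
    intro n
    have e : (∑ i, (n.1 i : ℂ) * w i).re = ∑ i, (n.1 i : ℝ) * (w i).re := by
      rw [Complex.re_sum]; simp
    have h1 : (∑ i, (n.1 i : ℝ)) * δ ≤ ∑ i, (n.1 i : ℝ) * (w i).re := by
      rw [Finset.sum_mul]
      exact Finset.sum_le_sum fun i _ => mul_le_mul_of_nonneg_left (hi₀ i) (by positivity)
    have h2 : (1 : ℝ) ≤ ∑ i, (n.1 i : ℝ) := by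
      obtain ⟨j, hj⟩ := Function.ne_iff.1 n.2
      have h3 : (1 : ℝ) ≤ n.1 j := by exact_mod_cast Nat.one_le_iff_ne_zero.2 hj
      exact h3.trans (Finset.single_le_sum (f := fun i => (n.1 i : ℝ))
        (fun i _ => by positivity) (Finset.mem_univ j))
    rw [e]
    nlinarith
  have hp : ∀ n : {n : Fin d → ℕ // n ≠ 0}, 0 < (∑ i, (n.1 i : ℂ) * w i).re := fun n =>
    lt_of_lt_of_le (by positivity) (hre n)
  have hs : Summable fun n : {n : Fin d → ℕ // n ≠ 0} =>
      (∑ i, (n.1 i : ℂ) * w i).re ^ (-α.re) := by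
    have h0 := ((aux_summ d hd α.re hα).subtype {n | n ≠ 0}).mul_left ((δ / 2) ^ (-α.re))
    refine Summable.of_nonneg_of_le (fun n => Real.rpow_nonneg (hp n).le _) (fun n => ?_) h0
    simp only [Function.comp]
    rw [← Real.mul_rpow (by positivity) (by positivity)]
    exact Real.rpow_le_rpow_of_nonpos (by positivity) (hre n) (by linarith)
  have hGs : ∀ t : ℝ, 0 < t → HasSum (fun n : {n : Fin d → ℕ // n ≠ 0} =>
      Complex.exp (-(∑ i, (n.1 i : ℂ) * w i) * t))
      ((∏ i, (1 - Complex.exp (-(w i) * t))⁻¹) - 1) := by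
    intro t ht
    have hx : ∀ i, ‖Complex.exp (-(w i) * t)‖ < 1 := by
      intro i
      rw [Complex.norm_exp, Real.exp_lt_one_iff]
      have := mul_pos (hw i) ht
      simpa using this
    have h1 := (aux_pi d (fun i n => Complex.exp (-(w i) * t) ^ n)
      (fun i => (summable_geometric_of_lt_one (norm_nonneg _) (hx i)).congr
        fun n => (norm_pow _ _).symm)).2
    simp_rw [fun i => tsum_geometric_of_norm_lt_one (hx i)] at h1
    have h2 := (Finset.hasSum_iff_compl ({0} : Finset (Fin d → ℕ))).1 h1
    simp only [Finset.sum_singleton, Pi.zero_apply, pow_zero, Finset.prod_const_one] at h2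
    have e : (fun n : {n : Fin d → ℕ // n ≠ 0} => Complex.exp (-(∑ i, (n.1 i : ℂ) * w i) * t))
        = fun n => ∏ i, Complex.exp (-(w i) * t) ^ (n.1 i) := by
      funext n
      simp_rw [← Complex.exp_nat_mul, ← Complex.exp_sum]
      congr 1
      rw [neg_mul, Finset.sum_mul, ← Finset.sum_neg_distrib]
      exact Finset.sum_congr rfl fun i _ => by ring
    rw [e]
    have := (Equiv.subtypeEquivRight (p := fun n : Fin d → ℕ => n ≠ 0)
      (q := fun n => n ∉ ({0} : Finset (Fin d → ℕ))) (fun n => by simp)).hasSum_iff.2 h2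
    exact this
  obtain ⟨hS, hI, hInt⟩ := aux_series (fun n : {n : Fin d → ℕ // n ≠ 0} => ∑ i, (n.1 i : ℂ) * w i)
    hp hσ0 hs (fun t : ℝ => (∏ i, (1 - Complex.exp (-(w i) * t))⁻¹) - 1) (by fun_prop) hGs
  have hre1 : ∀ k : ℕ, 0 < (α - d + k).re := by
    intro k
    have : (0 : ℝ) ≤ k := Nat.cast_nonneg k
    simp only [add_re, sub_re, natCast_re]
    linarith
  have hre2 : ∀ k : ℕ, 0 < (α + k).re := by
    intro k
    have : (0 : ℝ) ≤ k := Nat.cast_nonneg k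
    simp only [add_re, natCast_re]
    linarith
  let P : ℝ → ℂ := fun t => ∑ k ∈ Finset.range (M + 1),
    ((∏ i, w i)⁻¹ * ((-1 : ℂ) ^ k * b k / (k.factorial : ℂ))) *
      ((t : ℂ) ^ (α - d + k - 1) * Complex.exp (-c * t))
  let Q : ℝ → ℂ := fun t => ∑ k ∈ Finset.range (M + 1 - d),
    (c ^ k / (k.factorial : ℂ)) * ((t : ℂ) ^ (α + k - 1) * Complex.exp (-c * t))
  have hP : IntegrableOn P (Ioi 0) :=
    integrable_finsetSum _ fun k _ => (aux_int (hre1 k) hc).const_mul _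
  have hQ : IntegrableOn Q (Ioi 0) :=
    integrable_finsetSum _ fun k _ => (aux_int (hre2 k) hc).const_mul _
  have hPi : ∫ t in Ioi (0 : ℝ), P t = ∑ k ∈ Finset.range (M + 1),
      ((∏ i, w i)⁻¹ * ((-1 : ℂ) ^ k * b k / (k.factorial : ℂ))) *
        (Complex.Gamma (α - d + k) * c ^ (-(α - d + k))) := by
    rw [integral_finsetSum _ fun k _ => (aux_int (hre1 k) hc).const_mul _]
    refine Finset.sum_congr rfl fun k _ => ?_
    rw [integral_const_mul, aux_gamma (hre1 k) hc]
  have hQi : ∫ t in Ioi (0 : ℝ), Q t = ∑ k ∈ Finset.range (M + 1 - d),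
      (c ^ k / (k.factorial : ℂ)) * (Complex.Gamma (α + k) * c ^ (-(α + k))) := by
    rw [integral_finsetSum _ fun k _ => (aux_int (hre2 k) hc).const_mul _]
    refine Finset.sum_congr rfl fun k _ => ?_
    rw [integral_const_mul, aux_gamma (hre2 k) hc]
  have heq : ∀ t ∈ Ioi (0 : ℝ), (t : ℂ) ^ (α - 1) *
        ((∏ i, (1 - Complex.exp (-(w i) * t))⁻¹) - 1 -
          (t : ℂ) ^ (-(d : ℂ)) * Complex.exp (-c * t) / (∏ i, w i) *
            ∑ k ∈ Finset.range (M + 1), (-1 : ℂ) ^ k * b k * (t : ℂ) ^ k / (k.factorial : ℂ) +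
          Complex.exp (-c * t) *
            ∑ k ∈ Finset.range (M + 1 - d), (c * t) ^ k / (k.factorial : ℂ))
      = (t : ℂ) ^ (α - 1) * ((∏ i, (1 - Complex.exp (-(w i) * t))⁻¹) - 1) - P t + Q t := by
    intro t ht
    have ht0 : (t : ℂ) ≠ 0 := by exact_mod_cast (ne_of_gt ht)
    have eP : P t = (t : ℂ) ^ (α - 1) * ((t : ℂ) ^ (-(d : ℂ)) * Complex.exp (-c * t) / (∏ i, w i) *
            ∑ k ∈ Finset.range (M + 1), (-1 : ℂ) ^ k * b k * (t : ℂ) ^ k / (k.factorial : ℂ)) := by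
      simp only [P]
      rw [Finset.mul_sum, Finset.mul_sum]
      refine Finset.sum_congr rfl fun k _ => ?_
      rw [show α - d + k - 1 = (α - 1) + (-(d : ℂ)) + k by ring, cpow_add _ _ ht0,
        cpow_add _ _ ht0, cpow_natCast]
      ring
    have eQ : Q t = (t : ℂ) ^ (α - 1) * (Complex.exp (-c * t) *
            ∑ k ∈ Finset.range (M + 1 - d), (c * t) ^ k / (k.factorial : ℂ)) := by
      simp only [Q]
      rw [Finset.mul_sum, Finset.mul_sum]
      refine Finset.sum_congr rfl fun k _ => ?_
      rw [show α + k - 1 = (α - 1) + k by ring, cpow_add _ _ ht0, cpow_natCast]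
      ring
    rw [eP, eQ]
    ring
  refine ⟨hS, ?_, ?_⟩
  · exact ((hI.sub hP).add hQ).congr_fun (fun t ht => (heq t ht).symm) measurableSet_Ioi
  · have hsplit : ∫ t in Ioi (0 : ℝ), ((t : ℂ) ^ (α - 1) *
        ((∏ i, (1 - Complex.exp (-(w i) * t))⁻¹) - 1) - P t + Q t)
        = (∫ t in Ioi (0 : ℝ), (t : ℂ) ^ (α - 1) *
          ((∏ i, (1 - Complex.exp (-(w i) * t))⁻¹) - 1)) - (∫ t in Ioi (0 : ℝ), P t)
          + ∫ t in Ioi (0 : ℝ), Q t :=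
      (integral_add (hI.sub hP) hQ).trans (congrArg (· + _) (integral_sub hI hP))
    rw [setIntegral_congr_fun measurableSet_Ioi heq, hsplit, hInt, hPi, hQi]
    have e1 : (Complex.Gamma α * ∏ i, w i)⁻¹ *
          ∑ k ∈ Finset.range (M + 1),
            (-1 : ℂ) ^ k * b k * Complex.Gamma (α - d + k) /
              ((k.factorial : ℂ) * c ^ (α - d + k))
        = (Complex.Gamma α)⁻¹ * ∑ k ∈ Finset.range (M + 1),
      ((∏ i, w i)⁻¹ * ((-1 : ℂ) ^ k * b k / (k.factorial : ℂ))) *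
        (Complex.Gamma (α - d + k) * c ^ (-(α - d + k))) := by
      rw [Finset.mul_sum, Finset.mul_sum]
      refine Finset.sum_congr rfl fun k _ => ?_
      rw [cpow_neg, mul_inv, div_eq_mul_inv, mul_inv]
      ring
    have e2 : (Complex.Gamma α * c ^ α)⁻¹ *
            ∑ k ∈ Finset.range (M + 1 - d), Complex.Gamma (α + k) / (k.factorial : ℂ)
        = (Complex.Gamma α)⁻¹ * ∑ k ∈ Finset.range (M + 1 - d),
      (c ^ k / (k.factorial : ℂ)) * (Complex.Gamma (α + k) * c ^ (-(α + k))) := by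
      rw [Finset.mul_sum, Finset.mul_sum]
      refine Finset.sum_congr rfl fun k _ => ?_
      have hck : c ^ k ≠ 0 := pow_ne_zero _ hc0
      rw [cpow_neg, cpow_add _ _ hc0, cpow_natCast, mul_inv, mul_inv]
      field_simp
    rw [e1, e2, mul_add, mul_sub, inv_mul_cancel_left₀ hGne]
    ring
end
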